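/- If Yₙ is a noncentral chi-squared random variable with n ≥ 5 degrees of freedom and noncentrality parameter λ ≥ 0, then Var(1/Yₙ) ≤ 3·n⁻³·(1 − 2/n)⁻²·(1 − 4/n)⁻¹. -/

import Mathlib

open MeasureTheory ProbabilityTheory

/-- The noncentral chi-squared measure with `n` degrees of freedom and noncentrality
parameter `l`, via the Poisson mixture representation `χ²ₙ(l) =ᵈ χ²_{n+2N}`,
`N ~ Poisson(l/2)`, where `χ²_m = Gamma(m/2, 1/2)`. -/
noncomputable def noncentralChiSq (n : ℕ) (l : ℝ) : Measure ℝ :=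
  Measure.sum fun k : ℕ =>
    ENNReal.ofReal (Real.exp (-l / 2) * (l / 2) ^ k / k.factorial) •
      gammaMeasure ((n + 2 * k : ℝ) / 2) (1 / 2)

lemma pois0 (m : ℝ) : HasSum (fun k : ℕ => Real.exp (-m) * m ^ k / k.factorial) 1 := by
  have h := (NormedSpace.expSeries_div_hasSum_exp (m : ℝ)).mul_left (Real.exp (-m))
  rw [← Real.exp_eq_exp_ℝ, ← Real.exp_add, neg_add_cancel, Real.exp_zero] at h
  simpa only [mul_div_assoc] using h

lemma pois_shift (m : ℝ) (g : ℕ → ℝ) (S : ℝ)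
    (h : HasSum (fun k : ℕ => Real.exp (-m) * m ^ k / k.factorial * g (k + 1)) S) :
    HasSum (fun k : ℕ => Real.exp (-m) * m ^ k / k.factorial * (k * g k)) (m * S) := by
  have h2 := h.mul_left m
  rw [← hasSum_nat_add_iff' 1]
  simp only [Finset.sum_range_one, Nat.cast_zero, zero_mul, mul_zero, sub_zero]
  refine h2.congr_fun ?_
  intro k
  rw [Nat.factorial_succ]
  have : (k.factorial : ℝ) ≠ 0 := by positivity
  have : ((k : ℝ) + 1) ≠ 0 := by positivity
  push_cast
  field_simp
  try ring

lemma pois_var (m : ℝ) :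
    HasSum (fun k : ℕ => Real.exp (-m) * m ^ k / k.factorial * ((k : ℝ) - m) ^ 2) m := by
  have h0 := pois0 m
  have h1 := pois_shift m (fun _ => 1) 1 (by simpa using h0)
  have h2 := pois_shift m (fun k => (k : ℝ)) (m + 1) (by
    have := h1.add h0
    rw [mul_one] at this
    refine this.congr_fun ?_
    intro k
    push_cast
    ring)
  have h3 := (h2.add (h1.mul_left (-2 * m))).add (h0.mul_left (m ^ 2))
  have e : m * (m + 1) + -2 * m * (m * 1) + m ^ 2 * 1 = m := by ring
  rw [e] at h3
  refine h3.congr_fun ?_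
  intro k
  ring

lemma gamma_int {a r : ℝ} (ha : 0 < a) (hr : 0 < r) :
    Integrable (gammaPDFReal a r) ∧ ∫ x, gammaPDFReal a r x = 1 := by
  have h1 := lintegral_gammaPDF_eq_one ha hr
  have nn : 0 ≤ᵐ[volume] gammaPDFReal a r := ae_of_all _ (gammaPDFReal_nonneg ha hr)
  have hm : AEStronglyMeasurable (gammaPDFReal a r) volume :=
    (measurable_gammaPDFReal a r).aestronglyMeasurable
  constructor
  · refine ⟨hm, ?_⟩
    rw [hasFiniteIntegral_iff_ofReal nn]
    change ∫⁻ x, gammaPDF a r x < ⊤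
    rw [h1]; exact ENNReal.one_lt_top
  · rw [integral_eq_lintegral_of_nonneg_ae nn hm]
    change (∫⁻ x, gammaPDF a r x).toReal = 1
    rw [h1]; rfl

lemma gamma_step {a r x : ℝ} (ha : 0 < a) (hr : 0 < r) (hx : x ≠ 0) :
    x⁻¹ * gammaPDFReal (a + 1) r x = r / a * gammaPDFReal a r x := by
  unfold gammaPDFReal
  split_ifs with h
  · have hx' : 0 < x := lt_of_le_of_ne h (Ne.symm hx)
    rw [Real.Gamma_add_one ha.ne', Real.rpow_add_one hr.ne',
      show a + 1 - 1 = (a - 1) + 1 by ring, Real.rpow_add_one hx]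
    have := (Real.Gamma_pos_of_pos ha).ne'
    field_simp
  · simp

lemma gamma_lint {a r : ℝ} (ha : 0 < a) (hr : 0 < r) (c : ℝ) :
    ∫⁻ y, ENNReal.ofReal ((y⁻¹ - c) ^ 2) ∂(gammaMeasure (a + 1 + 1) r) =
      ENNReal.ofReal (r / (a + 1) * (r / a) - 2 * c * (r / (a + 1)) + c ^ 2) := by
  have ha1 : 0 < a + 1 := by linarith
  have ha2 : 0 < a + 1 + 1 := by linarith
  obtain ⟨i0, e0⟩ := gamma_int ha hr
  obtain ⟨i1, e1⟩ := gamma_int ha1 hr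
  obtain ⟨i2, e2⟩ := gamma_int ha2 hr
  have j0 := i0.const_mul (r / (a + 1) * (r / a))
  have j1 := i1.const_mul (2 * c * (r / (a + 1)))
  have j2 := i2.const_mul (c ^ 2)
  have key : ∀ᵐ y : ℝ, gammaPDFReal (a + 1 + 1) r y * (y⁻¹ - c) ^ 2 =
      r / (a + 1) * (r / a) * gammaPDFReal a r y - 2 * c * (r / (a + 1)) * gammaPDFReal (a + 1) r y
        + c ^ 2 * gammaPDFReal (a + 1 + 1) r y := by
    filter_upwards [compl_mem_ae_iff.mpr (measure_singleton (0 : ℝ))] with y hy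
    have hy0 : y ≠ 0 := hy
    have s1 := gamma_step ha hr hy0
    have s2 := gamma_step ha1 hr hy0
    linear_combination (y⁻¹ - 2 * c) * s2 + r / (a + 1) * s1
  have nn : 0 ≤ᵐ[volume] fun y => r / (a + 1) * (r / a) * gammaPDFReal a r y
      - 2 * c * (r / (a + 1)) * gammaPDFReal (a + 1) r y
        + c ^ 2 * gammaPDFReal (a + 1 + 1) r y := by
    filter_upwards [key] with y hy
    rw [Pi.zero_apply, ← hy]
    exact mul_nonneg (gammaPDFReal_nonneg ha2 hr y) (sq_nonneg _)
  rw [gammaMeasure, lintegral_withDensity_eq_lintegral_mul _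
    (by unfold gammaPDF; fun_prop) (by fun_prop)]
  have : ∫⁻ y, (gammaPDF (a + 1 + 1) r * fun y => ENNReal.ofReal ((y⁻¹ - c) ^ 2)) y =
      ∫⁻ y, ENNReal.ofReal (r / (a + 1) * (r / a) * gammaPDFReal a r y
      - 2 * c * (r / (a + 1)) * gammaPDFReal (a + 1) r y
        + c ^ 2 * gammaPDFReal (a + 1 + 1) r y) := by
    apply lintegral_congr_ae
    filter_upwards [key] with y hy
    rw [← hy, ENNReal.ofReal_mul (gammaPDFReal_nonneg ha2 hr y)]
    rfl
  refine this.trans ((ofReal_integral_eq_lintegral_ofReal ((j0.sub j1).add j2) nn).symm.trans ?_)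
  congr 1
  have A := integral_add (j0.sub j1) j2
  have B := integral_sub j0 j1
  refine A.trans ?_
  refine (congrArg (· + _) B).trans ?_
  rw [ integral_const_mul, integral_const_mul, integral_const_mul, e0, e1, e2]
  ring

lemma weight_bound (b m k : ℝ) (hb : 3 ≤ b) (hm : 0 ≤ m) (hk : 0 ≤ k) :
    1 / (b + 2 * k) * (1 / (b + 2 * k - 2)) - 2 * (1 / (b + 2 * m)) * (1 / (b + 2 * k))
      + (1 / (b + 2 * m)) ^ 2 ≤
    2 / (b ^ 2 * (b - 2)) + 4 / (b ^ 2 * (b + 2 * m) ^ 2) * (k - m) ^ 2 := by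
  have h1 : 0 < b + 2 * k := by linarith
  have h2 : 0 < b + 2 * k - 2 := by linarith
  have h3 : 0 < b + 2 * m := by linarith
  have h4 : 0 < b - 2 := by linarith
  have h5 : 0 < b := by linarith
  have e : 1 / (b + 2 * k) * (1 / (b + 2 * k - 2)) - 2 * (1 / (b + 2 * m)) * (1 / (b + 2 * k))
      + (1 / (b + 2 * m)) ^ 2 = 2 / ((b + 2 * k) ^ 2 * (b + 2 * k - 2)) +
        4 * (k - m) ^ 2 / ((b + 2 * k) ^ 2 * (b + 2 * m) ^ 2) := by
    field_simp
    ring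
  rw [e, div_mul_eq_mul_div]
  gcongr <;> linarith

lemma ncs_prob (n : ℕ) (hn : 5 ≤ n) (l : ℝ) (hl : 0 ≤ l) :
    IsProbabilityMeasure (noncentralChiSq n l) := by
  constructor
  have hn' : (5 : ℝ) ≤ n := by exact_mod_cast hn
  have hg : ∀ k : ℕ, gammaMeasure ((n + 2 * k : ℝ) / 2) (1 / 2) Set.univ = 1 := fun k =>
    (isProbabilityMeasure_gammaMeasure (by positivity) (by norm_num)).measure_univ
  have h0 := pois0 (l / 2)
  rw [noncentralChiSq, Measure.sum_apply _ MeasurableSet.univ]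
  simp only [Measure.smul_apply, hg, smul_eq_mul, mul_one, neg_div]
  rw [← ENNReal.ofReal_tsum_of_nonneg (fun k => by positivity) h0.summable, h0.tsum_eq,
    ENNReal.ofReal_one]

theorem stmt_10 (n : ℕ) (hn : 5 ≤ n) (l : ℝ) (hl : 0 ≤ l) :
    variance (fun y => y⁻¹) (noncentralChiSq n l) ≤
      3 * ((n : ℝ) ^ 3)⁻¹ * (1 - 2 / (n : ℝ))⁻¹ ^ 2 * (1 - 4 / (n : ℝ))⁻¹ := by
  have hn' : (5 : ℝ) ≤ n := by exact_mod_cast hn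
  have := ncs_prob n hn l hl
  obtain ⟨b, hb⟩ : ∃ b : ℝ, b = n - 2 := ⟨_, rfl⟩
  obtain ⟨m, hm⟩ : ∃ m : ℝ, m = l / 2 := ⟨_, rfl⟩
  have hm0 : 0 ≤ m := by rw [hm]; positivity
  have hb3 : 3 ≤ b := by linarith
  have h3 : 0 < b + 2 * m := by linarith
  have h4 : 0 < b - 2 := by linarith
  have h5 : 0 < b := by linarith
  have hmeas : Measurable (fun y : ℝ => y⁻¹) := measurable_inv
  rw [← variance_sub_const hmeas.aestronglyMeasurable (1 / (b + 2 * m))]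
  refine (variance_le_expectation_sq (hmeas.sub_const _).aestronglyMeasurable).trans ?_
  have hR : 3 * ((n : ℝ) ^ 3)⁻¹ * (1 - 2 / (n : ℝ))⁻¹ ^ 2 * (1 - 4 / (n : ℝ))⁻¹ =
      3 / (b ^ 2 * (b - 2)) := by
    have e : (n : ℝ) = b + 2 := by linarith
    rw [e]
    have x1 : 1 - 2 / (b + 2) = b / (b + 2) := by field_simp; ring
    have x2 : 1 - 4 / (b + 2) = (b - 2) / (b + 2) := by field_simp; ring
    rw [x1, x2]
    field_simp
  rw [hR]
  change ∫ y, (y⁻¹ - 1 / (b + 2 * m)) ^ 2 ∂noncentralChiSq n l ≤ _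
  rw [integral_eq_lintegral_of_nonneg_ae (ae_of_all _ fun y => sq_nonneg _)
    ((hmeas.sub_const _).pow_const 2).aestronglyMeasurable]
  refine ENNReal.toReal_le_of_le_ofReal (by positivity) ?_
  rw [noncentralChiSq, lintegral_sum_measure]
  have hs : HasSum (fun k : ℕ => Real.exp (-m) * m ^ k / k.factorial *
      (2 / (b ^ 2 * (b - 2)) + 4 / (b ^ 2 * (b + 2 * m) ^ 2) * ((k : ℝ) - m) ^ 2))
      (2 / (b ^ 2 * (b - 2)) * 1 + 4 / (b ^ 2 * (b + 2 * m) ^ 2) * m) := by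
    refine (((pois0 m).mul_left _).add ((pois_var m).mul_left _)).congr_fun ?_
    intro k
    ring
  have hT : 2 / (b ^ 2 * (b - 2)) * 1 + 4 / (b ^ 2 * (b + 2 * m) ^ 2) * m ≤
      3 / (b ^ 2 * (b - 2)) := by
    have : 4 / (b ^ 2 * (b + 2 * m) ^ 2) * m ≤ 1 / (b ^ 2 * (b - 2)) := by
      rw [div_mul_eq_mul_div, div_le_div_iff₀ (by positivity) (by positivity)]
      have : 4 * m * (b - 2) ≤ (b + 2 * m) ^ 2 := by nlinarith [sq_nonneg (b - 2 * m)]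
      nlinarith [mul_le_mul_of_nonneg_left this (sq_nonneg b)]
    have e : 3 / (b ^ 2 * (b - 2)) = 2 / (b ^ 2 * (b - 2)) * 1 + 1 / (b ^ 2 * (b - 2)) := by ring
    rw [e]
    linarith
  refine le_trans ?_ (ENNReal.ofReal_le_ofReal hT)
  rw [← hs.tsum_eq, ENNReal.ofReal_tsum_of_nonneg (fun k => by positivity) hs.summable]
  refine ENNReal.tsum_le_tsum fun k => ?_
  rw [lintegral_smul_measure, smul_eq_mul, ENNReal.ofReal_mul (by positivity), neg_div, ← hm]
  refine mul_le_mul_right ?_ _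
  have hk : (0 : ℝ) ≤ k := Nat.cast_nonneg k
  have ea : ((n : ℝ) + 2 * k) / 2 = (b + 2 * k - 2) / 2 + 1 + 1 := by rw [hb]; ring
  have hpos : 0 < (b + 2 * k - 2) / 2 := by linarith
  rw [ea]
  refine (gamma_lint hpos (by norm_num) (1 / (b + 2 * m))).trans_le ?_
  refine ENNReal.ofReal_le_ofReal ?_
  refine le_of_eq_of_le ?_ (weight_bound b m k hb3 hm0 hk)
  have h6 : 0 < b + 2 * k - 2 := by linarith
  have h7 : 0 < b + 2 * k := by linarith
  have y1 : (1 / 2 : ℝ) / ((b + 2 * k - 2) / 2 + 1) = 1 / (b + 2 * k) := by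
    rw [show (b + 2 * k - 2) / 2 + 1 = (b + 2 * k) / 2 by ring]; field_simp
  have y2 : (1 / 2 : ℝ) / ((b + 2 * k - 2) / 2) = 1 / (b + 2 * k - 2) := by field_simp
  rw [y1, y2]
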